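/- Let 3/8 < β ≤ 1 and let u : ℤ → ℂ be finitely supported. Then there is a constant C = C(β) independent of u with ‖F(u)‖_{h¹} ≤ C ‖u‖_{h¹} ‖u‖_{h^β}⁴, where F_j(u) = Σ_{(j₁,…,j₅)∈R(j)} u_{j₁} conj(u_{j₂}) u_{j₃} conj(u_{j₄}) u_{j₅}, ‖u‖_{h^s}² = Σ_j ⟨j⟩^{2s}|u_j|², and R(j) is the quintic resonant set. -/

import Mathlib

open scoped ComplexConjugate

/-- The quintic resonant tuples of total frequency `j` with all entries in `s`. -/
def resonantTuples (s : Finset ℤ) (j : ℤ) : Finset (ℤ × ℤ × ℤ × ℤ × ℤ) :=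
  (s ×ˢ s ×ˢ s ×ˢ s ×ˢ s).filter fun v =>
    v.1 - v.2.1 + v.2.2.1 - v.2.2.2.1 + v.2.2.2.2 = j ∧
    v.1 ^ 2 - v.2.1 ^ 2 + v.2.2.1 ^ 2 - v.2.2.2.1 ^ 2 + v.2.2.2.2 ^ 2 = j ^ 2

/-- A tuple is degenerate for `j` when `j` occurs among its odd-position entries. -/
def IsDegenerate (j : ℤ) (v : ℤ × ℤ × ℤ × ℤ × ℤ) : Prop :=
  v.1 = j ∨ v.2.2.1 = j ∨ v.2.2.2.2 = j

instance (j : ℤ) : DecidablePred (IsDegenerate j) := fun v => by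
  unfold IsDegenerate; infer_instance

/-- The product of the values of `a` along a tuple. -/
def tupleProd (a : ℤ → ℝ) (v : ℤ × ℤ × ℤ × ℤ × ℤ) : ℝ :=
  a v.1 * a v.2.1 * a v.2.2.1 * a v.2.2.2.1 * a v.2.2.2.2

lemma tupleProd_nonneg {a : ℤ → ℝ} (ha : ∀ n, 0 ≤ a n) (v : ℤ × ℤ × ℤ × ℤ × ℤ) :
    0 ≤ tupleProd a v := by
  have := ha v.1; have := ha v.2.1; have := ha v.2.2.1; have := ha v.2.2.2.1
  have := ha v.2.2.2.2
  unfold tupleProd; positivity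

lemma mem_resonantTuples {s : Finset ℤ} {j a b c d e : ℤ} :
    (a, b, c, d, e) ∈ resonantTuples s j ↔
      (a ∈ s ∧ b ∈ s ∧ c ∈ s ∧ d ∈ s ∧ e ∈ s) ∧ a - b + c - d + e = j ∧
        a ^ 2 - b ^ 2 + c ^ 2 - d ^ 2 + e ^ 2 = j ^ 2 := by
  simp [resonantTuples]

/-- A pair of integers is determined up to order by its sum and its sum of squares. -/
lemma pair_eq_of_sum_eq_of_sq_eq {a b c d : ℤ} (h : a + b = c + d)
    (h2 : a ^ 2 + b ^ 2 = c ^ 2 + d ^ 2) : (a = c ∧ b = d) ∨ (a = d ∧ b = c) := by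
  have : (a - c) * (a - d) = 0 := by
    have hb : b = c + d - a := by linarith
    subst hb
    linarith [show 2 * ((a - c) * (a - d)) = 0 by linarith]
  rcases mul_eq_zero.mp this with h' | h'
  · left; constructor <;> linarith
  · right; constructor <;> linarith

lemma sum_comp_le_of_card_fiber_le {α κ : Type*} [DecidableEq κ] {t : Finset α} {r : Finset κ}
    {φ : α → κ} {g : κ → ℝ} {m : ℕ} (hg : ∀ w, 0 ≤ g w) (hφ : ∀ v ∈ t, φ v ∈ r)
    (hm : ∀ w, (t.filter fun v => φ v = w).card ≤ m) :
    ∑ v ∈ t, g (φ v) ≤ m * ∑ w ∈ r, g w := by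
  rw [← Finset.sum_fiberwise_of_maps_to hφ, Finset.mul_sum]
  refine Finset.sum_le_sum fun w _ => ?_
  rw [Finset.sum_congr rfl (g := fun _ => g w)
    (fun v hv => by rw [(Finset.mem_filter.mp hv).2]), Finset.sum_const, nsmul_eq_mul]
  exact mul_le_mul_of_nonneg_right (by exact_mod_cast hm w) (hg w)

lemma card_le_two_of_involution {α : Type*} [DecidableEq α] {t : Finset α} (σ : α → α)
    (h : ∀ v ∈ t, ∀ w ∈ t, w = v ∨ w = σ v) : t.card ≤ 2 := by
  rcases t.eq_empty_or_nonempty with rfl | ⟨v, hv⟩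
  · simp
  · refine (Finset.card_le_card (t := {v, σ v}) fun w hw => ?_).trans Finset.card_le_two
    simpa using h v hv w hw

lemma sum_triple_product_le {s : Finset ℤ} {f : ℤ → ℝ} {S : ℝ} (hf : ∀ n, 0 ≤ f n)
    (hS : ∑ n ∈ s, f n ≤ S) :
    ∑ w ∈ s ×ˢ s ×ˢ s, f w.1 * f w.2.1 * f w.2.2 ≤ S ^ 3 := by
  have : ∑ w ∈ s ×ˢ s ×ˢ s, f w.1 * f w.2.1 * f w.2.2 = (∑ n ∈ s, f n) ^ 3 := by
    simp only [Finset.sum_product, mul_assoc, ← Finset.mul_sum, ← Finset.sum_mul]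
    ring
  rw [this]
  exact pow_le_pow_left₀ (Finset.sum_nonneg fun n _ => hf n) hS 3

lemma mul_pow_three_le {x y z w : ℝ} :
    x ^ 3 * y ^ 3 * z ^ 3 * w ^ 3 ≤ y ^ 4 * z ^ 4 * w ^ 4 + x ^ 4 * z ^ 4 * w ^ 4 +
      x ^ 4 * y ^ 4 * w ^ 4 + x ^ 4 * y ^ 4 * z ^ 4 := by
  have key : ∀ A B C D : ℝ, A * B * C * D ≤ A ^ 4 + B ^ 4 + C ^ 4 + D ^ 4 := fun A B C D => by
    nlinarith [sq_nonneg (A * B - C * D), sq_nonneg (A ^ 2 - B ^ 2), sq_nonneg (C ^ 2 - D ^ 2),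
      sq_nonneg (A ^ 2 + B ^ 2), sq_nonneg (C ^ 2 + D ^ 2)]
  calc _ = (y * z * w) * (x * z * w) * (x * y * w) * (x * y * z) := by ring
    _ ≤ _ := key _ _ _ _
    _ = _ := by ring

/-- Weighted count of the nondegenerate resonant tuples, uniformly in `j`. -/
lemma sum_nondegenerate_weight_le {s : Finset ℤ} {z : ℤ → ℝ} {S : ℝ}
    (hS : ∑ n ∈ s, z n ^ 4 ≤ S) (j : ℤ) :
    ∑ v ∈ (resonantTuples s j).filter (fun v => ¬ IsDegenerate j v),
      z v.2.1 ^ 3 * z v.2.2.1 ^ 3 * z v.2.2.2.1 ^ 3 * z v.2.2.2.2 ^ 3 ≤ 8 * S ^ 3 := by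
  set t := (resonantTuples s j).filter (fun v => ¬ IsDegenerate j v) with ht
  have hmem : ∀ {a b c d e : ℤ}, (a, b, c, d, e) ∈ t ↔
      ((a ∈ s ∧ b ∈ s ∧ c ∈ s ∧ d ∈ s ∧ e ∈ s) ∧ a - b + c - d + e = j ∧
        a ^ 2 - b ^ 2 + c ^ 2 - d ^ 2 + e ^ 2 = j ^ 2) ∧ ¬ (a = j ∨ c = j ∨ e = j) := by
    intro a b c d e
    rw [ht, Finset.mem_filter, mem_resonantTuples]; rfl
  have hz : ∀ n, 0 ≤ z n ^ 4 := fun n => by positivity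
  have main : ∀ φ : ℤ × ℤ × ℤ × ℤ × ℤ → ℤ × ℤ × ℤ, (∀ v ∈ t, φ v ∈ s ×ˢ s ×ˢ s) →
      (∀ w, (t.filter fun v => φ v = w).card ≤ 2) →
      ∑ v ∈ t, z (φ v).1 ^ 4 * z (φ v).2.1 ^ 4 * z (φ v).2.2 ^ 4 ≤ 2 * S ^ 3 := by
    intro φ h1 h2
    have := sum_comp_le_of_card_fiber_le
      (g := fun w : ℤ × ℤ × ℤ => z w.1 ^ 4 * z w.2.1 ^ 4 * z w.2.2 ^ 4)
      (fun w => by positivity) h1 h2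
    have h3 := sum_triple_product_le hz hS
    push_cast at this
    linarith
  have linear_unique : ∀ {a b a' b' p q : ℤ}, a - b = p → a ^ 2 - b ^ 2 = q → a' - b' = p →
      a' ^ 2 - b' ^ 2 = q → p ≠ 0 → a' = a ∧ b' = b := by
    intro a b a' b' p q h1 h2 h3 h4 hp
    have : p * ((a' + b') - (a + b)) = 0 := by
      have e1 : p * (a + b) = q := by rw [← h1, ← h2]; ring
      have e2 : p * (a' + b') = q := by rw [← h3, ← h4]; ring
      linarith
    have := (mul_eq_zero.mp this).resolve_left hp
    omega
  have b1 := main (fun v => (v.2.2.1, v.2.2.2.1, v.2.2.2.2))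
    (by rintro ⟨a, b, c, d, e⟩ h; have := hmem.mp h; simp; tauto)
    (fun w => card_le_two_of_involution id <| by
      rintro ⟨a, b, c, d, e⟩ h ⟨a', b', c', d', e'⟩ h'
      simp only [Finset.mem_filter, hmem] at h h'
      obtain ⟨⟨⟨-, h1, h2⟩, h3⟩, rfl⟩ := h
      obtain ⟨⟨⟨-, h1', h2'⟩, h3'⟩, h4'⟩ := h'
      simp only [Prod.mk.injEq] at h4'
      obtain ⟨rfl, rfl, rfl⟩ := h4'
      have hp : a - b ≠ 0 := fun h0 => by
        obtain rfl : a = b := by linarith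
        rcases pair_eq_of_sum_eq_of_sq_eq (a := c') (b := e') (c := j) (d := d') (by linarith)
          (by linarith) with h | h <;> tauto
      obtain ⟨rfl, rfl⟩ := linear_unique rfl rfl (a' := a') (b' := b') (by linarith)
        (by linarith) hp
      exact Or.inl rfl)
  have b2 := main (fun v => (v.2.1, v.2.2.2.1, v.2.2.2.2))
    (by rintro ⟨a, b, c, d, e⟩ h; have := hmem.mp h; simp; tauto)
    (fun w => card_le_two_of_involution (fun v => (v.2.2.1, v.2.1, v.1, v.2.2.2)) <| by
      rintro ⟨a, b, c, d, e⟩ h ⟨a', b', c', d', e'⟩ h'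
      simp only [Finset.mem_filter, hmem] at h h'
      obtain ⟨⟨⟨-, h1, h2⟩, h3⟩, rfl⟩ := h
      obtain ⟨⟨⟨-, h1', h2'⟩, h3'⟩, h4'⟩ := h'
      simp only [Prod.mk.injEq] at h4'
      obtain ⟨rfl, rfl, rfl⟩ := h4'
      rcases pair_eq_of_sum_eq_of_sq_eq (a := a') (b := c') (c := a) (d := c) (by linarith)
        (by linarith) with ⟨rfl, rfl⟩ | ⟨rfl, rfl⟩ <;> simp)
  have b3 := main (fun v => (v.2.1, v.2.2.1, v.2.2.2.2))
    (by rintro ⟨a, b, c, d, e⟩ h; have := hmem.mp h; simp; tauto)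
    (fun w => card_le_two_of_involution id <| by
      rintro ⟨a, b, c, d, e⟩ h ⟨a', b', c', d', e'⟩ h'
      simp only [Finset.mem_filter, hmem] at h h'
      obtain ⟨⟨⟨-, h1, h2⟩, h3⟩, rfl⟩ := h
      obtain ⟨⟨⟨-, h1', h2'⟩, h3'⟩, h4'⟩ := h'
      simp only [Prod.mk.injEq] at h4'
      obtain ⟨rfl, rfl, rfl⟩ := h4'
      have hp : a - d ≠ 0 := fun h0 => by
        obtain rfl : a = d := by linarith
        rcases pair_eq_of_sum_eq_of_sq_eq (a := c') (b := e') (c := j) (d := b') (by linarith)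
          (by linarith) with h | h <;> tauto
      obtain ⟨rfl, rfl⟩ := linear_unique rfl rfl (a' := a') (b' := d') (by linarith)
        (by linarith) hp
      exact Or.inl rfl)
  have b4 := main (fun v => (v.2.1, v.2.2.1, v.2.2.2.1))
    (by rintro ⟨a, b, c, d, e⟩ h; have := hmem.mp h; simp; tauto)
    (fun w => card_le_two_of_involution
        (fun v => (v.2.2.2.2, v.2.1, v.2.2.1, v.2.2.2.1, v.1)) <| by
      rintro ⟨a, b, c, d, e⟩ h ⟨a', b', c', d', e'⟩ h'
      simp only [Finset.mem_filter, hmem] at h h'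
      obtain ⟨⟨⟨-, h1, h2⟩, h3⟩, rfl⟩ := h
      obtain ⟨⟨⟨-, h1', h2'⟩, h3'⟩, h4'⟩ := h'
      simp only [Prod.mk.injEq] at h4'
      obtain ⟨rfl, rfl, rfl⟩ := h4'
      rcases pair_eq_of_sum_eq_of_sq_eq (a := a') (b := e') (c := a) (d := e) (by linarith)
        (by linarith) with ⟨rfl, rfl⟩ | ⟨rfl, rfl⟩ <;> simp)
  calc _ ≤ ∑ v ∈ t, (z v.2.2.1 ^ 4 * z v.2.2.2.1 ^ 4 * z v.2.2.2.2 ^ 4 +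
          z v.2.1 ^ 4 * z v.2.2.2.1 ^ 4 * z v.2.2.2.2 ^ 4 +
          z v.2.1 ^ 4 * z v.2.2.1 ^ 4 * z v.2.2.2.2 ^ 4 +
          z v.2.1 ^ 4 * z v.2.2.1 ^ 4 * z v.2.2.2.1 ^ 4) :=
        Finset.sum_le_sum fun v _ => mul_pow_three_le
    _ ≤ _ := by
        simp only [Finset.sum_add_distrib]
        linarith

/-- Degenerate tuples contribute at most a multiple of `a j * (∑ a²)²`. -/
lemma sum_degenerate_le {s : Finset ℤ} {a : ℤ → ℝ} (ha : ∀ n, 0 ≤ a n) (j : ℤ) :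
    ∑ v ∈ (resonantTuples s j).filter (fun v => IsDegenerate j v), tupleProd a v ≤
      6 * (a j * (∑ n ∈ s, a n ^ 2) ^ 2) := by
  have hdeg : ∀ {p b c d e : ℤ}, p - b + c - d + e = j →
      p ^ 2 - b ^ 2 + c ^ 2 - d ^ 2 + e ^ 2 = j ^ 2 → (p = j ∨ c = j ∨ e = j) →
      (p = j ∧ c = b ∧ e = d) ∨ (p = j ∧ c = d ∧ e = b) ∨ (c = j ∧ p = b ∧ e = d) ∨
      (c = j ∧ p = d ∧ e = b) ∨ (e = j ∧ p = b ∧ c = d) ∨ (e = j ∧ p = d ∧ c = b) := by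
    rintro p b c d e h1 h2 (rfl | rfl | rfl)
    · rcases pair_eq_of_sum_eq_of_sq_eq (a := c) (b := e) (c := b) (d := d) (by linarith)
        (by linarith) with h | h <;> tauto
    · rcases pair_eq_of_sum_eq_of_sq_eq (a := p) (b := e) (c := b) (d := d) (by linarith)
        (by linarith) with h | h <;> tauto
    · rcases pair_eq_of_sum_eq_of_sq_eq (a := p) (b := c) (c := b) (d := d) (by linarith)
        (by linarith) with h | h <;> tauto
  have key := sum_comp_le_of_card_fiber_le
    (t := (resonantTuples s j).filter (fun v => IsDegenerate j v)) (r := s ×ˢ s)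
    (φ := fun v => (v.2.1, v.2.2.2.1)) (g := fun w => a j * (a w.1 ^ 2 * a w.2 ^ 2)) (m := 6)
    (fun w => mul_nonneg (ha j) (by positivity))
    (by
      rintro ⟨p, b, c, d, e⟩ h
      rw [Finset.mem_filter, mem_resonantTuples] at h
      simp; tauto)
    (by
      rintro ⟨b, d⟩
      refine (Finset.card_le_card (t := {(j, b, b, d, d), (j, b, d, d, b), (b, b, j, d, d),
        (d, b, j, d, b), (b, b, d, d, j), (d, b, b, d, j)}) ?_).trans Finset.card_le_six
      rintro ⟨p, b', c, d', e⟩ h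
      rw [Finset.mem_filter, Finset.mem_filter, mem_resonantTuples] at h
      obtain ⟨⟨⟨-, h1, h2⟩, h3⟩, h4⟩ := h
      simp only [Prod.mk.injEq] at h4
      obtain ⟨rfl, rfl⟩ := h4
      rcases hdeg h1 h2 h3 with h | h | h | h | h | h <;> simp [h])
  have e1 : ∑ w ∈ s ×ˢ s, a j * (a w.1 ^ 2 * a w.2 ^ 2) = a j * (∑ n ∈ s, a n ^ 2) ^ 2 := by
    simp only [Finset.sum_product, ← Finset.mul_sum, ← Finset.sum_mul]
    ring
  rw [e1] at key
  refine le_trans (le_of_eq (Finset.sum_congr rfl ?_)) (by exact_mod_cast key)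
  rintro ⟨p, b, c, d, e⟩ h
  rw [Finset.mem_filter, mem_resonantTuples] at h
  obtain ⟨⟨-, h1, h2⟩, h3⟩ := h
  rcases hdeg h1 h2 h3 with h | h | h | h | h | h <;> obtain ⟨rfl, rfl, rfl⟩ := h <;>
    simp only [tupleProd] <;> ring

/-- The nondegenerate tuples of total frequency `j` whose first entry dominates `j`. -/
def dominatedTuples (s : Finset ℤ) (j : ℤ) : Finset (ℤ × ℤ × ℤ × ℤ × ℤ) :=
  ((resonantTuples s j).filter (fun v => ¬ IsDegenerate j v)).filter (fun v => j ^ 2 ≤ 3 * v.1 ^ 2)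

lemma sum_nondegenerate_le {s : Finset ℤ} {a : ℤ → ℝ} (ha : ∀ n, 0 ≤ a n) (j : ℤ) :
    ∑ v ∈ (resonantTuples s j).filter (fun v => ¬ IsDegenerate j v), tupleProd a v ≤
      3 * ∑ v ∈ dominatedTuples s j, tupleProd a v := by
  set t := (resonantTuples s j).filter (fun v => ¬ IsDegenerate j v) with ht
  have hmem : ∀ {a b c d e : ℤ}, (a, b, c, d, e) ∈ t ↔
      ((a ∈ s ∧ b ∈ s ∧ c ∈ s ∧ d ∈ s ∧ e ∈ s) ∧ a - b + c - d + e = j ∧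
        a ^ 2 - b ^ 2 + c ^ 2 - d ^ 2 + e ^ 2 = j ^ 2) ∧ ¬ (a = j ∨ c = j ∨ e = j) := by
    intro a b c d e
    rw [ht, Finset.mem_filter, mem_resonantTuples]; rfl
  have e3 : ∑ v ∈ t.filter (fun v => j ^ 2 ≤ 3 * v.2.2.1 ^ 2), tupleProd a v =
      ∑ v ∈ dominatedTuples s j, tupleProd a v := by
    refine Finset.sum_nbij' (fun v => (v.2.2.1, v.2.1, v.1, v.2.2.2))
      (fun v => (v.2.2.1, v.2.1, v.1, v.2.2.2)) ?_ ?_ ?_ ?_ ?_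
    · rintro ⟨p, b, c, d, e⟩ h
      simp only [dominatedTuples, Finset.mem_filter, ← ht, hmem] at h ⊢
      refine ⟨⟨⟨by tauto, by linarith, by linarith⟩, by tauto⟩, by tauto⟩
    · rintro ⟨p, b, c, d, e⟩ h
      simp only [dominatedTuples, Finset.mem_filter, ← ht, hmem] at h ⊢
      refine ⟨⟨⟨by tauto, by linarith, by linarith⟩, by tauto⟩, by tauto⟩
    · intros; rfl
    · intros; rfl
    · intros; simp only [tupleProd]; ring
  have e5 : ∑ v ∈ t.filter (fun v => j ^ 2 ≤ 3 * v.2.2.2.2 ^ 2), tupleProd a v =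
      ∑ v ∈ dominatedTuples s j, tupleProd a v := by
    refine Finset.sum_nbij' (fun v => (v.2.2.2.2, v.2.1, v.2.2.1, v.2.2.2.1, v.1))
      (fun v => (v.2.2.2.2, v.2.1, v.2.2.1, v.2.2.2.1, v.1)) ?_ ?_ ?_ ?_ ?_
    · rintro ⟨p, b, c, d, e⟩ h
      simp only [dominatedTuples, Finset.mem_filter, ← ht, hmem] at h ⊢
      refine ⟨⟨⟨by tauto, by linarith, by linarith⟩, by tauto⟩, by tauto⟩
    · rintro ⟨p, b, c, d, e⟩ h
      simp only [dominatedTuples, Finset.mem_filter, ← ht, hmem] at h ⊢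
      refine ⟨⟨⟨by tauto, by linarith, by linarith⟩, by tauto⟩, by tauto⟩
    · intros; rfl
    · intros; rfl
    · intros; simp only [tupleProd]; ring
  have e1 : ∑ v ∈ t.filter (fun v => j ^ 2 ≤ 3 * v.1 ^ 2), tupleProd a v =
      ∑ v ∈ dominatedTuples s j, tupleProd a v := rfl
  have hsplit : ∑ v ∈ t, tupleProd a v ≤
      ∑ v ∈ t.filter (fun v => j ^ 2 ≤ 3 * v.1 ^ 2), tupleProd a v +
      ∑ v ∈ t.filter (fun v => j ^ 2 ≤ 3 * v.2.2.1 ^ 2), tupleProd a v +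
      ∑ v ∈ t.filter (fun v => j ^ 2 ≤ 3 * v.2.2.2.2 ^ 2), tupleProd a v := by
    simp only [Finset.sum_filter, ← Finset.sum_add_distrib]
    refine Finset.sum_le_sum ?_
    rintro ⟨p, b, c, d, e⟩ h
    have h0 := tupleProd_nonneg ha (p, b, c, d, e)
    have : j ^ 2 ≤ 3 * p ^ 2 ∨ j ^ 2 ≤ 3 * c ^ 2 ∨ j ^ 2 ≤ 3 * e ^ 2 := by
      obtain ⟨⟨-, -, h2⟩, -⟩ := hmem.mp h
      by_contra! hc
      nlinarith [sq_nonneg b, sq_nonneg d]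
    dsimp only
    split_ifs <;> first | (exfalso; tauto) | linarith
  linarith

/-- Summing over disjoint families of tuples recovers at most the full product sum. -/
lemma sum_sum_dominatedTuples_le {s K : Finset ℤ} {f g : ℤ → ℝ} (hf : ∀ n, 0 ≤ f n)
    (hg : ∀ n, 0 ≤ g n) :
    ∑ j ∈ K, ∑ v ∈ dominatedTuples s j,
        f v.1 * g v.2.1 * g v.2.2.1 * g v.2.2.2.1 * g v.2.2.2.2 ≤
      (∑ n ∈ s, f n) * (∑ n ∈ s, g n) ^ 4 := by
  have hnn : ∀ v : ℤ × ℤ × ℤ × ℤ × ℤ,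
      0 ≤ f v.1 * g v.2.1 * g v.2.2.1 * g v.2.2.2.1 * g v.2.2.2.2 := fun v =>
    mul_nonneg (mul_nonneg (mul_nonneg (mul_nonneg (hf _) (hg _)) (hg _)) (hg _)) (hg _)
  have hJ : ∀ j, ∀ v ∈ dominatedTuples s j, v ∈ s ×ˢ s ×ˢ s ×ˢ s ×ˢ s ∧
      v.1 - v.2.1 + v.2.2.1 - v.2.2.2.1 + v.2.2.2.2 = j := by
    intro j v hv
    simp only [dominatedTuples, resonantTuples, Finset.mem_filter] at hv
    tauto
  rw [← Finset.sum_biUnion (fun i _ j _ hij => Finset.disjoint_left.mpr fun v hi hj =>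
    hij ((hJ i v hi).2.symm.trans (hJ j v hj).2))]
  refine (Finset.sum_le_sum_of_subset_of_nonneg (t := s ×ˢ s ×ˢ s ×ˢ s ×ˢ s) ?_
    fun v _ _ => hnn v).trans (le_of_eq ?_)
  · intro v hv
    obtain ⟨j, -, hv⟩ := Finset.mem_biUnion.mp hv
    exact (hJ j v hv).1
  · simp only [Finset.sum_product, mul_assoc, ← Finset.mul_sum, ← Finset.sum_mul]
    ring

lemma sum_dominated_sq_le {β : ℝ} {s K : Finset ℤ} {a : ℤ → ℝ} {S : ℝ}
    (hS : ∑ n ∈ s, ((1 + (n : ℝ) ^ 2) ^ (-β / 3)) ^ 4 ≤ S) :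
    ∑ j ∈ K, (1 + (j : ℝ) ^ 2) * (∑ v ∈ dominatedTuples s j, tupleProd a v) ^ 2 ≤
      24 * S ^ 3 * ((∑ n ∈ s, (1 + (n : ℝ) ^ 2) * a n ^ 2) *
        (∑ n ∈ s, (1 + (n : ℝ) ^ 2) ^ β * a n ^ 2) ^ 4) := by
  set z : ℤ → ℝ := fun n => (1 + (n : ℝ) ^ 2) ^ (-β / 3) with hz
  set y : ℤ → ℝ := fun n => (1 + (n : ℝ) ^ 2) ^ β with hy
  have hz0 : ∀ n, 0 < z n := fun n => by positivity
  have hy0 : ∀ n, 0 < y n := fun n => by positivity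
  have hzy : ∀ n, z n ^ 3 * y n = 1 := fun n => by
    have hp : (0 : ℝ) < 1 + (n : ℝ) ^ 2 := by positivity
    simp only [hz, hy]
    rw [← Real.rpow_natCast, ← Real.rpow_mul hp.le, ← Real.rpow_add hp]
    norm_num
  have hS0 : 0 ≤ S := le_trans (Finset.sum_nonneg fun n _ => by positivity) hS
  have step : ∀ j : ℤ, (1 + (j : ℝ) ^ 2) * (∑ v ∈ dominatedTuples s j, tupleProd a v) ^ 2 ≤
      24 * S ^ 3 * ∑ v ∈ dominatedTuples s j, ((1 + (v.1 : ℝ) ^ 2) * a v.1 ^ 2) *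
        (y v.2.1 * a v.2.1 ^ 2) * (y v.2.2.1 * a v.2.2.1 ^ 2) *
        (y v.2.2.2.1 * a v.2.2.2.1 ^ 2) * (y v.2.2.2.2 * a v.2.2.2.2 ^ 2) := by
    intro j
    set W : ℤ × ℤ × ℤ × ℤ × ℤ → ℝ := fun v =>
      z v.2.1 ^ 3 * z v.2.2.1 ^ 3 * z v.2.2.2.1 ^ 3 * z v.2.2.2.2 ^ 3
    set G : ℤ × ℤ × ℤ × ℤ × ℤ → ℝ := fun v => a v.1 ^ 2 *
        (y v.2.1 * a v.2.1 ^ 2) * (y v.2.2.1 * a v.2.2.1 ^ 2) *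
        (y v.2.2.2.1 * a v.2.2.2.1 ^ 2) * (y v.2.2.2.2 * a v.2.2.2.2 ^ 2)
    have hW : ∀ v, 0 ≤ W v := fun v => by
      have := hz0 v.2.1; have := hz0 v.2.2.1; have := hz0 v.2.2.2.1; have := hz0 v.2.2.2.2
      positivity
    have hG : ∀ v, 0 ≤ G v := fun v => by
      have := hy0 v.2.1; have := hy0 v.2.2.1; have := hy0 v.2.2.2.1; have := hy0 v.2.2.2.2
      positivity
    have cs : (∑ v ∈ dominatedTuples s j, tupleProd a v) ^ 2 ≤
        (∑ v ∈ dominatedTuples s j, W v) * ∑ v ∈ dominatedTuples s j, G v := by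
      refine Finset.sum_sq_le_sum_mul_sum_of_sq_le_mul _ (fun v _ => hW v) (fun v _ => hG v) ?_
      intro v _
      refine le_of_eq ?_
      calc tupleProd a v ^ 2 = tupleProd a v ^ 2 * (z v.2.1 ^ 3 * y v.2.1) *
            (z v.2.2.1 ^ 3 * y v.2.2.1) * (z v.2.2.2.1 ^ 3 * y v.2.2.2.1) *
            (z v.2.2.2.2 ^ 3 * y v.2.2.2.2) := by simp only [hzy, mul_one]
        _ = W v * G v := by simp only [tupleProd, W, G]; ring
    have hWS : ∑ v ∈ dominatedTuples s j, W v ≤ 8 * S ^ 3 :=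
      (Finset.sum_le_sum_of_subset_of_nonneg (Finset.filter_subset _ _)
        fun v _ _ => hW v).trans (sum_nondegenerate_weight_le hS j)
    calc _ ≤ (1 + (j : ℝ) ^ 2) * (8 * S ^ 3 * ∑ v ∈ dominatedTuples s j, G v) := by
          refine mul_le_mul_of_nonneg_left (cs.trans ?_) (by positivity)
          exact mul_le_mul_of_nonneg_right hWS (Finset.sum_nonneg fun v _ => hG v)
      _ = 8 * S ^ 3 * ∑ v ∈ dominatedTuples s j, (1 + (j : ℝ) ^ 2) * G v := by
          rw [← Finset.mul_sum]; ring
      _ ≤ 8 * S ^ 3 * ∑ v ∈ dominatedTuples s j, 3 * ((1 + (v.1 : ℝ) ^ 2) * G v) := by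
          refine mul_le_mul_of_nonneg_left (Finset.sum_le_sum fun v hv => ?_) (by positivity)
          have h1 : (j : ℝ) ^ 2 ≤ 3 * (v.1 : ℝ) ^ 2 := by
            exact_mod_cast (Finset.mem_filter.mp hv).2
          have h2 : 1 + (j : ℝ) ^ 2 ≤ 3 * (1 + (v.1 : ℝ) ^ 2) := by linarith
          calc _ ≤ _ := mul_le_mul_of_nonneg_right h2 (hG v)
            _ = _ := by ring
      _ = _ := by
          rw [← Finset.mul_sum, ← mul_assoc]
          congr 1
          · ring
          · exact Finset.sum_congr rfl fun v _ => by simp only [G]; ring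
  refine (Finset.sum_le_sum fun j _ => step j).trans ?_
  rw [← Finset.mul_sum]
  refine mul_le_mul_of_nonneg_left ?_ (by positivity)
  exact sum_sum_dominatedTuples_le (f := fun n => (1 + (n : ℝ) ^ 2) * a n ^ 2)
    (g := fun n => y n * a n ^ 2) (fun n => by positivity)
    (fun n => mul_nonneg (hy0 n).le (sq_nonneg _))

/-- The quintic estimate for nonnegative sequences, with finite sums. -/
lemma sum_resonant_sq_le {β : ℝ} (hβ : 0 ≤ β) {s K : Finset ℤ} {a : ℤ → ℝ} {S : ℝ}
    (ha : ∀ n, 0 ≤ a n) (has : ∀ n, n ∉ s → a n = 0)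
    (hS : ∑ n ∈ s, ((1 + (n : ℝ) ^ 2) ^ (-β / 3)) ^ 4 ≤ S) :
    ∑ j ∈ K, (1 + (j : ℝ) ^ 2) * (∑ v ∈ resonantTuples s j, tupleProd a v) ^ 2 ≤
      (72 + 432 * S ^ 3) * ((∑ n ∈ s, (1 + (n : ℝ) ^ 2) * a n ^ 2) *
        (∑ n ∈ s, (1 + (n : ℝ) ^ 2) ^ β * a n ^ 2) ^ 4) := by
  set M := ∑ n ∈ s, (1 + (n : ℝ) ^ 2) * a n ^ 2
  set N := ∑ n ∈ s, (1 + (n : ℝ) ^ 2) ^ β * a n ^ 2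
  set L := ∑ n ∈ s, a n ^ 2
  have hL0 : 0 ≤ L := Finset.sum_nonneg fun n _ => sq_nonneg _
  have hM0 : 0 ≤ M := Finset.sum_nonneg fun n _ => by positivity
  have hLN : L ≤ N := Finset.sum_le_sum fun n _ =>
    le_mul_of_one_le_left (sq_nonneg _)
      (Real.one_le_rpow (by linarith [sq_nonneg (n : ℝ)]) hβ)
  have hKM : ∑ j ∈ K, (1 + (j : ℝ) ^ 2) * a j ^ 2 ≤ M := by
    calc _ ≤ ∑ j ∈ K ∪ s, (1 + (j : ℝ) ^ 2) * a j ^ 2 :=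
          Finset.sum_le_sum_of_subset_of_nonneg Finset.subset_union_left
            fun n _ _ => by positivity
      _ = M := (Finset.sum_subset Finset.subset_union_right
          fun n _ hn => by rw [has n hn]; simp).symm
  have step : ∀ j ∈ K, (1 + (j : ℝ) ^ 2) * (∑ v ∈ resonantTuples s j, tupleProd a v) ^ 2 ≤
      72 * L ^ 4 * ((1 + (j : ℝ) ^ 2) * a j ^ 2) +
      18 * ((1 + (j : ℝ) ^ 2) * (∑ v ∈ dominatedTuples s j, tupleProd a v) ^ 2) := by
    intro j _
    have h1 := sum_degenerate_le (s := s) ha j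
    have h2 := sum_nondegenerate_le (s := s) ha j
    have h3 := Finset.sum_filter_add_sum_filter_not (resonantTuples s j)
      (fun v => IsDegenerate j v) (tupleProd a)
    have h0 : 0 ≤ ∑ v ∈ resonantTuples s j, tupleProd a v :=
      Finset.sum_nonneg fun v _ => tupleProd_nonneg ha v
    set B := ∑ v ∈ dominatedTuples s j, tupleProd a v
    have h4 : ∑ v ∈ resonantTuples s j, tupleProd a v ≤ 6 * (a j * L ^ 2) + 3 * B := by
      linarith
    have h5 : (∑ v ∈ resonantTuples s j, tupleProd a v) ^ 2 ≤
        72 * L ^ 4 * a j ^ 2 + 18 * B ^ 2 := by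
      have := pow_le_pow_left₀ h0 h4 2
      nlinarith [sq_nonneg (6 * (a j * L ^ 2) - 3 * B)]
    have := mul_le_mul_of_nonneg_left h5 (show 0 ≤ 1 + (j : ℝ) ^ 2 by positivity)
    linarith
  refine (Finset.sum_le_sum step).trans ?_
  rw [Finset.sum_add_distrib, ← Finset.mul_sum, ← Finset.mul_sum]
  have h1 := sum_dominated_sq_le (K := K) (a := a) hS
  have h2 : L ^ 4 * ∑ j ∈ K, (1 + (j : ℝ) ^ 2) * a j ^ 2 ≤ N ^ 4 * M :=
    mul_le_mul (pow_le_pow_left₀ hL0 hLN 4) hKM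
      (Finset.sum_nonneg fun n _ => by positivity) (by positivity)
  linarith

lemma summable_bracket_rpow {β : ℝ} (hβ : 3 / 8 < β) :
    Summable fun n : ℤ => ((1 + (n : ℝ) ^ 2) ^ (-β / 3)) ^ 4 := by
  refine Summable.of_norm_bounded_eventually
    (Real.summable_abs_int_rpow (b := 8 * β / 3) (by linarith)) ?_
  filter_upwards [(Set.finite_singleton (0 : ℤ)).compl_mem_cofinite] with n hn
  have hn' : (0 : ℝ) < |(n : ℝ)| := abs_pos.mpr (by exact_mod_cast hn)
  rw [Real.norm_of_nonneg (by positivity), ← Real.rpow_natCast,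
    ← Real.rpow_mul (by positivity), show -(8 * β / 3) = 2 * (-β / 3 * (4 : ℕ)) by push_cast; ring,
    Real.rpow_mul hn'.le]
  refine Real.rpow_le_rpow_of_nonpos (by positivity) ?_ (by push_cast; linarith)
  rw [Real.rpow_two, sq_abs]
  linarith

lemma tsum_eq_sum_resonantTuples {s : Finset ℤ} {u : ℤ → ℂ} (hu : ∀ n, n ∉ s → u n = 0) (j : ℤ) :
    ∑' v : {v : ℤ × ℤ × ℤ × ℤ × ℤ //
        v.1 - v.2.1 + v.2.2.1 - v.2.2.2.1 + v.2.2.2.2 = j ∧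
        v.1 ^ 2 - v.2.1 ^ 2 + v.2.2.1 ^ 2 - v.2.2.2.1 ^ 2 + v.2.2.2.2 ^ 2 = j ^ 2},
      u v.val.1 * conj (u v.val.2.1) * u v.val.2.2.1 * conj (u v.val.2.2.2.1) *
        u v.val.2.2.2.2 =
    ∑ v ∈ resonantTuples s j,
      u v.1 * conj (u v.2.1) * u v.2.2.1 * conj (u v.2.2.2.1) * u v.2.2.2.2 := by
  refine (tsum_subtype {v : ℤ × ℤ × ℤ × ℤ × ℤ |
        v.1 - v.2.1 + v.2.2.1 - v.2.2.2.1 + v.2.2.2.2 = j ∧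
        v.1 ^ 2 - v.2.1 ^ 2 + v.2.2.1 ^ 2 - v.2.2.2.1 ^ 2 + v.2.2.2.2 ^ 2 = j ^ 2}
    (fun v => u v.1 * conj (u v.2.1) * u v.2.2.1 * conj (u v.2.2.2.1) * u v.2.2.2.2)).trans ?_
  rw [tsum_eq_sum (s := resonantTuples s j)]
  · refine Finset.sum_congr rfl fun v hv => Set.indicator_of_mem ?_ _
    exact (Finset.mem_filter.mp hv).2
  · rintro ⟨p, b, c, d, e⟩ hv
    by_cases h : p ∈ s ∧ b ∈ s ∧ c ∈ s ∧ d ∈ s ∧ e ∈ s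
    · refine Set.indicator_of_notMem (fun h' => hv ?_) _
      exact mem_resonantTuples.mpr ⟨h, h'⟩
    · refine Set.indicator_apply_eq_zero.mpr fun _ => ?_
      have : p ∉ s ∨ b ∉ s ∨ c ∉ s ∨ d ∉ s ∨ e ∉ s := by tauto
      rcases this with h | h | h | h | h <;> simp [hu _ h]

/-- Refined quintic nonlinear estimate `‖F(u)‖_{h¹} ≲ ‖u‖_{h¹} ‖u‖_{h^β}⁴` for `3/8 < β ≤ 1`. -/
theorem quintic_nonlinear_estimate_beta (β : ℝ) (hβ1 : 3 / 8 < β) (hβ2 : β ≤ 1) :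
    ∃ C : ℝ, 0 < C ∧ ∀ u : ℤ → ℂ, (Function.support u).Finite →
      Real.sqrt (∑' j : ℤ, (1 + (j : ℝ) ^ 2) *
          ‖∑' v : {v : ℤ × ℤ × ℤ × ℤ × ℤ //
              v.1 - v.2.1 + v.2.2.1 - v.2.2.2.1 + v.2.2.2.2 = j ∧
              v.1 ^ 2 - v.2.1 ^ 2 + v.2.2.1 ^ 2 - v.2.2.2.1 ^ 2 + v.2.2.2.2 ^ 2 = j ^ 2},
            u v.val.1 * conj (u v.val.2.1) * u v.val.2.2.1 *
              conj (u v.val.2.2.2.1) * u v.val.2.2.2.2‖ ^ 2)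
        ≤ C * Real.sqrt (∑' j : ℤ, (1 + (j : ℝ) ^ 2) * ‖u j‖ ^ 2) *
            Real.sqrt (∑' j : ℤ, (1 + (j : ℝ) ^ 2) ^ β * ‖u j‖ ^ 2) ^ 4 := by
  set S := ∑' n : ℤ, ((1 + (n : ℝ) ^ 2) ^ (-β / 3)) ^ 4
  have hS0 : 0 ≤ S := tsum_nonneg fun n => by positivity
  refine ⟨Real.sqrt (72 + 432 * S ^ 3), by positivity, fun u hfin => ?_⟩
  set s := hfin.toFinset
  have hu : ∀ n, n ∉ s → u n = 0 := fun n hn => by simpa [s] using hn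
  have hS : ∑ n ∈ s, ((1 + (n : ℝ) ^ 2) ^ (-β / 3)) ^ 4 ≤ S :=
    (summable_bracket_rpow hβ1).sum_le_tsum s fun n _ => by positivity
  simp only [tsum_eq_sum_resonantTuples hu]
  rw [tsum_eq_sum (s := s) (f := fun j : ℤ => (1 + (j : ℝ) ^ 2) * ‖u j‖ ^ 2)
      (fun n hn => by simp [hu n hn]),
    tsum_eq_sum (s := s) (f := fun j : ℤ => (1 + (j : ℝ) ^ 2) ^ β * ‖u j‖ ^ 2)
      (fun n hn => by simp [hu n hn])]
  set M := ∑ n ∈ s, (1 + (n : ℝ) ^ 2) * ‖u n‖ ^ 2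
  set N := ∑ n ∈ s, (1 + (n : ℝ) ^ 2) ^ β * ‖u n‖ ^ 2
  have hN0 : 0 ≤ N := Finset.sum_nonneg fun n _ => by positivity
  have hR : Real.sqrt (72 + 432 * S ^ 3) * Real.sqrt M * Real.sqrt N ^ 4 =
      Real.sqrt ((72 + 432 * S ^ 3) * (M * N ^ 4)) := by
    rw [Real.sqrt_mul (by positivity), Real.sqrt_mul' _ (by positivity),
      show N ^ 4 = (N ^ 2) ^ 2 by ring, Real.sqrt_sq (by positivity),
      show Real.sqrt N ^ 4 = (Real.sqrt N ^ 2) ^ 2 by ring, Real.sq_sqrt hN0, mul_assoc]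
  rw [hR]
  refine Real.sqrt_le_sqrt (Real.tsum_le_of_sum_le (fun j => by positivity) fun K => ?_)
  refine le_trans (Finset.sum_le_sum fun j _ => ?_)
    (sum_resonant_sq_le (K := K) (a := fun n => ‖u n‖) (by linarith) (fun n => norm_nonneg _)
      (fun n hn => by simp [hu n hn]) hS)
  refine mul_le_mul_of_nonneg_left (pow_le_pow_left₀ (norm_nonneg _) ?_ 2) (by positivity)
  refine (norm_sum_le _ _).trans (le_of_eq (Finset.sum_congr rfl fun v _ => ?_))
  simp [tupleProd]
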